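/- arXiv:2407.01263 — 8 statements merged into one kernel-verified Lean document; each statement's English description precedes it below -/
import Mathlib

section
/- Suppose the input alphabet X is partitioned into two disjoint nonempty sets S and R (X = S ∪ R, S ∩ R = ∅), and suppose that for every b ∈ R there exists a pmf c^b on S such that P_b(y) = ∑_{s∈S} c^b_s · P_s(y) for all y ∈ Y (i.e., each P_b lies in the convex hull of the conditional distributions of the symbols in S). Then removing the symbols in R incurs no loss in capacity: C(W_X) = C(W_S). -/
open scoped BigOperators Classical

/-- A probability mass function on a finite alphabet `Y`. -/
def IsPmf {Y : Type*} [Fintype Y] (p : Y → ℝ) : Prop :=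
  (∀ y, 0 ≤ p y) ∧ ∑ y, p y = 1

/-- The real-valued KL sum `∑_{y : p y > 0} p y * log (p y / q y)` (natural log). -/
noncomputable def klReal {Y : Type*} [Fintype Y] (p q : Y → ℝ) : ℝ :=
  ∑ y, if 0 < p y then p y * Real.log (p y / q y) else 0

/-- KL divergence in `[0,∞] ⊆ EReal`, with the convention `D(p‖q) = ⊤`
if `supp p ⊄ supp q`. -/
noncomputable def KL {Y : Type*} [Fintype Y] (p q : Y → ℝ) : EReal :=
  if ∀ y, 0 < p y → 0 < q y then ((klReal p q : ℝ) : EReal) else ⊤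

/-- The capacity of the channel restricted to input symbols in `S`,
via the minimax (information-radius) formula, with convention `C(W_∅) = 0`. -/
noncomputable def capacity {X Y : Type*} [Fintype X] [Fintype Y]
    (P : X → Y → ℝ) (S : Set X) : EReal :=
  if S.Nonempty then
    ⨅ Q : {Q : Y → ℝ // IsPmf Q}, ⨆ x : S, KL (P (x : X)) Q.1
  else 0

theorem klReal_eq_sum_mul_log {Y : Type*} [Fintype Y] {p : Y → ℝ} (hp : ∀ y, 0 ≤ p y)
    (q : Y → ℝ) : klReal p q = ∑ y, p y * Real.log (p y / q y) := by
  refine Finset.sum_congr rfl fun y _ => ?_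
  split_ifs with h
  · rfl
  · simp [le_antisymm (not_lt.mp h) (hp y)]

theorem convexOn_mul_log_div (q : ℝ) :
    ConvexOn ℝ (Set.Ici 0) fun t : ℝ => t * Real.log (t / q) := by
  rcases eq_or_ne q 0 with rfl | hq
  · simpa using convexOn_const (0 : ℝ) (convex_Ici (0 : ℝ))
  · have hlin : ConvexOn ℝ (Set.Ici 0) fun t : ℝ => t * -Real.log q :=
      ((LinearMap.id : ℝ →ₗ[ℝ] ℝ).smulRight (-Real.log q)).convexOn (convex_Ici 0)
    refine (Real.convexOn_mul_log.add hlin).congr fun t _ => ?_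
    rcases eq_or_ne t 0 with rfl | ht
    · simp
    · simp only [Pi.add_apply]
      rw [Real.log_div ht hq]
      ring

theorem klReal_sum_le {X Y : Type*} [Fintype X] [Fintype Y] {P : X → Y → ℝ}
    (hP : ∀ x y, 0 ≤ P x y) (q : Y → ℝ) {c : X → ℝ} (hc : ∀ x, 0 ≤ c x)
    (hc1 : ∑ x, c x = 1) :
    klReal (fun y => ∑ x, c x * P x y) q ≤ ∑ x, c x * klReal (P x) q := by
  rw [klReal_eq_sum_mul_log fun y => Finset.sum_nonneg fun x _ => mul_nonneg (hc x) (hP x y)]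
  simp_rw [klReal_eq_sum_mul_log (hP _), Finset.mul_sum]
  rw [Finset.sum_comm]
  refine Finset.sum_le_sum fun y _ => ?_
  simpa only [smul_eq_mul] using (convexOn_mul_log_div (q y)).map_sum_le
    (t := Finset.univ) (w := c) (p := fun x => P x y) (fun x _ => hc x) hc1 fun x _ => hP x y

/-- The divergence of a mixture is at most that of some component of positive weight. -/
theorem exists_KL_sum_le {X Y : Type*} [Fintype X] [Fintype Y] {P : X → Y → ℝ}
    (hP : ∀ x y, 0 ≤ P x y) (q : Y → ℝ) {c : X → ℝ} (hc : ∀ x, 0 ≤ c x)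
    (hc1 : ∑ x, c x = 1) :
    ∃ x, 0 < c x ∧ KL (fun y => ∑ x, c x * P x y) q ≤ KL (P x) q := by
  by_cases hsupp : ∀ x, 0 < c x → ∀ y, 0 < P x y → 0 < q y
  · have hmix : ∀ y, 0 < ∑ x, c x * P x y → 0 < q y := fun y hy => by
      obtain ⟨x, -, hx⟩ := Finset.exists_lt_of_sum_lt (s := Finset.univ)
        (f := fun _ : X => (0 : ℝ)) (by simpa using hy)
      have hcx : 0 < c x := (hc x).lt_of_ne fun h => by simp [← h] at hx
      exact hsupp x hcx y (pos_of_mul_pos_right hx hcx.le)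
    by_contra! hlt
    obtain ⟨x₀, -, hx₀⟩ := Finset.exists_lt_of_sum_lt (s := Finset.univ)
      (f := fun _ : X => (0 : ℝ)) (g := c) (by simp [hc1])
    have hreal : ∀ x, 0 < c x → klReal (P x) q < klReal (fun y => ∑ x, c x * P x y) q :=
      fun x hx => by
        have h := hlt x hx
        rw [KL, KL, if_pos (hsupp x hx), if_pos hmix] at h
        exact_mod_cast h
    have hsum : ∑ x, c x * klReal (P x) q
        < ∑ x, c x * klReal (fun y => ∑ x, c x * P x y) q := by
      refine Finset.sum_lt_sum (fun x _ => ?_)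
        ⟨x₀, Finset.mem_univ _, mul_lt_mul_of_pos_left (hreal x₀ hx₀) hx₀⟩
      rcases (hc x).eq_or_lt with h | h
      · simp [← h]
      · exact mul_le_mul_of_nonneg_left (hreal x h).le h.le
    rw [← Finset.sum_mul, hc1, one_mul] at hsum
    exact absurd (klReal_sum_le hP q hc hc1) (not_le.mpr hsum)
  · push Not at hsupp
    obtain ⟨x, hx, y, hy, hqy⟩ := hsupp
    refine ⟨x, hx, ?_⟩
    have htop : KL (P x) q = ⊤ := if_neg fun h => absurd (h y hy) (not_lt.mpr hqy)
    exact htop ▸ le_top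

/-- if the rows of every symbol in `R` lie in the convex hull of the
rows of the symbols in `S`, where `S, R` partition the input alphabet `X`, then
removing the symbols in `R` incurs no loss in capacity: `C(W_X) = C(W_S)`. -/
theorem capacity_eq_of_redundant_symbols_in_convex_hull
    {X Y : Type*} [Fintype X] [Fintype Y] [Nonempty X] [Nonempty Y]
    (P : X → Y → ℝ) (hP : ∀ x, IsPmf (P x))
    (S R : Set X) (hS : S.Nonempty) (hR : R.Nonempty)
    (hdisj : S ∩ R = ∅) (hcover : S ∪ R = Set.univ)
    (hhull : ∀ b ∈ R, ∃ c : X → ℝ, (∀ x, 0 ≤ c x) ∧ (∀ x, x ∉ S → c x = 0) ∧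
      (∑ x, c x) = 1 ∧ ∀ y, P b y = ∑ s, c s * P s y) :
    capacity P Set.univ = capacity P S := by
  rw [capacity, capacity, if_pos Set.univ_nonempty, if_pos hS]
  refine iInf_congr fun Q => le_antisymm (iSup_le fun ⟨x, _⟩ => ?_)
    (iSup_le fun s => le_iSup_of_le ⟨s, Set.mem_univ _⟩ le_rfl)
  by_cases hx : x ∈ S
  · exact le_iSup_of_le ⟨x, hx⟩ le_rfl
  · have hxR : x ∈ R := (hcover ▸ Set.mem_univ x : x ∈ S ∪ R).resolve_left hx
    obtain ⟨c, hc, hcS, hc1, hmix⟩ := hhull x hxR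
    obtain ⟨s, hs, hle⟩ := exists_KL_sum_le (fun x => (hP x).1) Q.1 hc hc1
    have hsS : s ∈ S := by
      by_contra h
      exact hs.ne' (hcS s h)
    refine le_iSup_of_le ⟨s, hsS⟩ ?_
    rwa [← funext hmix] at hle
end

section
/- Let b ∈ X and suppose there exists a pmf c on X∖{b} such that P_b(y) = ∑_{s∈X∖{b}} c_s · P_s(y) for all y ∈ Y. Then for every input pmf π on X there exists an input pmf π′ on X with π′(b) = 0 and I(π′;W) ≥ I(π;W). Consequently, there exists a maximizer of π ↦ I(π;W) that assigns zero probability to the symbol b. -/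
open scoped BigOperators Classical

/-- The output pmf induced by input distribution `π` through the channel `P`. -/
noncomputable def outputDist {X Y : Type*} [Fintype X] [Fintype Y]
    (π : X → ℝ) (P : X → Y → ℝ) : Y → ℝ :=
  fun y => ∑ x, π x * P x y

/-- Mutual information `I(π; W) = ∑_x π x · D(P_x ‖ Q_π)`. -/
noncomputable def mutualInfo {X Y : Type*} [Fintype X] [Fintype Y]
    (π : X → ℝ) (P : X → Y → ℝ) : ℝ :=
  ∑ x, π x * klReal (P x) (outputDist π P)

/-- On input pmfs, mutual information is output entropy minus conditional entropy. -/
theorem mutualInfo_eq_entropy_sub {X Y : Type*} [Fintype X] [Fintype Y]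
    {P : X → Y → ℝ} (hP : ∀ x, IsPmf (P x)) {π : X → ℝ} (hπ : IsPmf π) :
    mutualInfo π P = ∑ y, Real.negMulLog (∑ x, π x * P x y) -
      ∑ x, π x * ∑ y, Real.negMulLog (P x y) := by
  have key (x : X) (y : Y) :
      π x * (if 0 < P x y then P x y * Real.log (P x y / outputDist π P y) else 0) =
        -(π x * P x y * Real.log (outputDist π P y)) - π x * Real.negMulLog (P x y) := by
    rcases (hπ.1 x).eq_or_lt with h | hx
    · simp [← h]
    rcases ((hP x).1 y).eq_or_lt with h | hy
    · simp [← h]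
    have hq : 0 < outputDist π P y :=
      (mul_pos hx hy).trans_le (Finset.single_le_sum (f := fun x => π x * P x y)
        (fun x _ => mul_nonneg (hπ.1 x) ((hP x).1 y)) (Finset.mem_univ x))
    rw [if_pos hy, Real.log_div hy.ne' hq.ne', Real.negMulLog]
    ring
  unfold mutualInfo klReal
  simp_rw [Finset.mul_sum, key, Finset.sum_sub_distrib]
  congr 1
  rw [Finset.sum_comm]
  refine Finset.sum_congr rfl fun y _ => ?_
  rw [Finset.sum_neg_distrib, ← Finset.sum_mul, Real.negMulLog]
  simp [outputDist]

theorem continuousOn_mutualInfo {X Y : Type*} [Fintype X] [Fintype Y]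
    {P : X → Y → ℝ} (hP : ∀ x, IsPmf (P x)) :
    ContinuousOn (fun π => mutualInfo π P) {π | IsPmf π} := by
  refine ContinuousOn.congr (Continuous.continuousOn ?_)
    fun π hπ => mutualInfo_eq_entropy_sub hP hπ
  have := Real.continuous_negMulLog
  fun_prop

/-- Entropy is concave: a mixture has at least the average entropy of its components. -/
theorem sum_mul_entropy_le {X Y : Type*} [Fintype X] [Fintype Y]
    {P : X → Y → ℝ} (hP : ∀ x, IsPmf (P x)) {c : X → ℝ} (hc : IsPmf c) :
    ∑ x, c x * ∑ y, Real.negMulLog (P x y) ≤ ∑ y, Real.negMulLog (∑ x, c x * P x y) := by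
  simp_rw [Finset.mul_sum]
  rw [Finset.sum_comm]
  refine Finset.sum_le_sum fun y _ => ?_
  simpa only [smul_eq_mul] using Real.concaveOn_negMulLog.le_map_sum
    (fun x _ => hc.1 x) hc.2 (fun x _ => Set.mem_Ici.2 ((hP x).1 y))

/-- Moving the mass of a redundant symbol onto the mixture representing it does not decrease
mutual information. -/
theorem exists_avoiding_mutualInfo_le {X Y : Type*} [Fintype X] [Fintype Y]
    {P : X → Y → ℝ} (hP : ∀ x, IsPmf (P x)) {b : X} {c : X → ℝ} (hc : IsPmf c)
    (hcb : c b = 0) (hb : ∀ y, P b y = ∑ s, c s * P s y) {π : X → ℝ} (hπ : IsPmf π) :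
    ∃ π' : X → ℝ, IsPmf π' ∧ π' b = 0 ∧ mutualInfo π P ≤ mutualInfo π' P := by
  let π' : X → ℝ := fun x => π x + π b * (c x - if x = b then 1 else 0)
  have hsum (f : X → ℝ) : ∑ x, π' x * f x = ∑ x, π x * f x + π b * (∑ x, c x * f x - f b) := by
    simp [π', add_mul, mul_assoc, sub_mul, Finset.sum_add_distrib, ← Finset.mul_sum]
  have hπ'b : π' b = 0 := by simp [π', hcb]
  have hπ' : IsPmf π' := by
    refine ⟨fun x => ?_, by simpa [hπ.2, hc.2] using hsum 1⟩
    by_cases hx : x = b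
    · rw [hx, hπ'b]
    · simpa [π', hx] using add_nonneg (hπ.1 x) (mul_nonneg (hπ.1 b) (hc.1 x))
  refine ⟨π', hπ', hπ'b, ?_⟩
  have hent := sum_mul_entropy_le hP hc
  simp_rw [← hb] at hent
  rw [mutualInfo_eq_entropy_sub hP hπ, mutualInfo_eq_entropy_sub hP hπ', hsum]
  simp_rw [hsum, ← hb, sub_self, mul_zero, add_zero]
  nlinarith [mul_nonneg (hπ.1 b) (sub_nonneg.2 hent)]

/-- if the row of symbol `b` is a convex combination of the other rows,
then every input pmf can be replaced by one assigning zero mass to `b` without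
decreasing mutual information; consequently some maximizer of `π ↦ I(π;W)`
assigns zero probability to `b`. -/
theorem exists_maximizer_avoiding_redundant_symbol
    {X Y : Type*} [Fintype X] [Fintype Y] [Nonempty X] [Nonempty Y]
    (P : X → Y → ℝ) (hP : ∀ x, IsPmf (P x)) (b : X)
    (hc : ∃ c : X → ℝ, (∀ x, 0 ≤ c x) ∧ c b = 0 ∧ (∑ x, c x) = 1 ∧
      ∀ y, P b y = ∑ s, c s * P s y) :
    (∀ π : X → ℝ, IsPmf π → ∃ π' : X → ℝ, IsPmf π' ∧ π' b = 0 ∧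
        mutualInfo π P ≤ mutualInfo π' P) ∧
    (∃ πstar : X → ℝ, IsPmf πstar ∧ πstar b = 0 ∧
        ∀ π : X → ℝ, IsPmf π → mutualInfo π P ≤ mutualInfo πstar P) := by
  obtain ⟨c, hc0, hcb, hc1, hb⟩ := hc
  have hc : IsPmf c := ⟨hc0, hc1⟩
  have hred (π : X → ℝ) (hπ : IsPmf π) := exists_avoiding_mutualInfo_le hP hc hcb hb hπ
  refine ⟨hred, ?_⟩
  have hcompact : IsCompact ({π : X → ℝ | IsPmf π} ∩ {π | π b = 0}) :=
    (isCompact_stdSimplex ℝ X).inter_right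
      (isClosed_eq (continuous_apply b) continuous_const)
  obtain ⟨πstar, ⟨hpmf, hzero⟩, hmax⟩ := hcompact.exists_isMaxOn ⟨c, hc, hcb⟩
    ((continuousOn_mutualInfo hP).mono Set.inter_subset_left)
  refine ⟨πstar, hpmf, hzero, fun π hπ => ?_⟩
  obtain ⟨π', hπ', hπ'b, hle⟩ := hred π hπ
  exact hle.trans (hmax ⟨hπ', hπ'b⟩)
end

section
/- There exist a finite channel W = (P_x)_{x∈X}, subsets A ⊊ B ⊆ X, and a symbol j ∈ X∖B, such that C(W_{A∪{j}}) − C(W_A) < C(W_{B∪{j}}) − C(W_B), where by convention C(W_∅) = 0. Hence the set function S ↦ C(W_S) on subsets of the input alphabet is not submodular (it violates the diminishing-returns property). -/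
open scoped BigOperators Classical

theorem isPmf_pointMass {Y : Type*} [Fintype Y] [DecidableEq Y] (x : Y) :
    IsPmf (Pi.single x (1 : ℝ)) :=
  ⟨fun y => by by_cases h : y = x <;> simp [h], by simp⟩

theorem KL_pointMass {Y : Type*} [Fintype Y] [DecidableEq Y] (x : Y) (Q : Y → ℝ) :
    KL (Pi.single x (1 : ℝ)) Q = if 0 < Q x then ((-Real.log (Q x) : ℝ) : EReal) else ⊤ := by
  have supp (y : Y) : 0 < (Pi.single x (1 : ℝ) : Y → ℝ) y ↔ y = x := by
    by_cases h : y = x <;> simp [h]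
  simp [KL, klReal, supp]

theorem le_KL_pointMass {Y : Type*} [Fintype Y] [DecidableEq Y] {x : Y} {Q : Y → ℝ} {c : ℝ}
    (h : Q x ≤ c) : ((-Real.log c : ℝ) : EReal) ≤ KL (Pi.single x (1 : ℝ)) Q := by
  rw [KL_pointMass]
  split_ifs with hQ
  · exact EReal.coe_le_coe_iff.mpr (neg_le_neg (Real.log_le_log hQ h))
  · exact le_top

/-- The noiseless channel has zero capacity when restricted to a single symbol. -/
theorem capacity_noiseless_singleton {Y : Type*} [Fintype Y] [DecidableEq Y] (x : Y) :
    capacity (fun x : Y => Pi.single x (1 : ℝ)) {x} = 0 := by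
  rw [capacity, if_pos (Set.singleton_nonempty x)]
  apply le_antisymm
  · refine iInf_le_of_le ⟨_, isPmf_pointMass x⟩ (iSup_le ?_)
    rintro ⟨y, rfl⟩
    simp [KL_pointMass]
  · refine le_iInf fun Q => le_iSup_of_le ⟨x, rfl⟩ ?_
    have hQ : Q.1 x ≤ 1 :=
      Q.2.2 ▸ Finset.single_le_sum (fun y _ => Q.2.1 y) (Finset.mem_univ x)
    simpa using le_KL_pointMass hQ

/-- The noiseless binary channel has capacity at least `log 2`. -/
theorem log_two_le_capacity_noiseless_binary :
    ((Real.log 2 : ℝ) : EReal) ≤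
      capacity (fun x : Fin 2 => Pi.single x (1 : ℝ)) Set.univ := by
  rw [capacity, if_pos Set.univ_nonempty]
  refine le_iInf fun Q => ?_
  have hQ : Q.1 0 + Q.1 1 = 1 := by simpa using Q.2.2
  obtain ⟨x, hx⟩ : ∃ x, Q.1 x ≤ 2⁻¹ := by
    by_contra! h
    linarith [h 0, h 1]
  exact le_iSup_of_le ⟨x, trivial⟩ (by simpa using le_KL_pointMass hx)

/-- the capacity, as a set function of the selected input symbols,
is not submodular: there is a channel, sets `A ⊊ B` and a symbol `j ∉ B` violating
the diminishing-returns inequality. (By convention `C(W_∅) = 0`, as built into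
`capacity`.) -/
theorem capacity_not_submodular :
    ∃ (n m : ℕ), 0 < n ∧ 0 < m ∧ ∃ P : Fin n → Fin m → ℝ,
      (∀ x, IsPmf (P x)) ∧ ∃ (A B : Set (Fin n)) (j : Fin n),
        A ⊂ B ∧ j ∉ B ∧
        capacity P (A ∪ {j}) - capacity P A <
          capacity P (B ∪ {j}) - capacity P B := by
  refine ⟨2, 2, two_pos, two_pos, fun x => Pi.single x 1, isPmf_pointMass, ∅, {0}, 1, ?_, ?_, ?_⟩
  · simp
  · simp
  · have hB : ({0} ∪ {1} : Set (Fin 2)) = Set.univ := by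
      ext x
      fin_cases x <;> simp
    have hA : capacity (fun x : Fin 2 => Pi.single x (1 : ℝ)) ∅ = 0 := by simp [capacity]
    rw [hB, Set.empty_union, hA, capacity_noiseless_singleton, capacity_noiseless_singleton,
      sub_zero, sub_zero]
    exact (EReal.coe_pos.mpr (Real.log_pos one_lt_two)).trans_le
      log_two_le_capacity_noiseless_binary
end

section
/- Let p and q be pmfs on a finite set Y with p ≠ q. Then the information radius of the two-point family {p, q}, namely ⨅_{Q pmf on Y} max(D(p‖Q), D(q‖Q)), is at least JSD(p‖q), and JSD(p‖q) > 0. In particular, a channel with two distinct rows has strictly positive capacity. -/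
open scoped BigOperators Classical

/-- The Jensen–Shannon divergence `JSD(p‖q) = ½ D(p‖M) + ½ D(q‖M)`, `M = (p+q)/2`. -/
noncomputable def JSD {Y : Type*} [Fintype Y] (p q : Y → ℝ) : ℝ :=
  (1 / 2) * klReal p (fun y => (p y + q y) / 2)
    + (1 / 2) * klReal q (fun y => (p y + q y) / 2)

/-- Termwise form of the Gibbs inequality, with equality only on the diagonal. -/
lemma sub_lt_klTerm {a b : ℝ} (ha : 0 ≤ a) (hb : 0 ≤ b) (hab : 0 < a → 0 < b) (hne : a ≠ b) :
    a - b < if 0 < a then a * Real.log (a / b) else 0 := by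
  split_ifs with h
  · have hb' := hab h
    have hlog : Real.log (b / a) < b / a - 1 :=
      Real.log_lt_sub_one_of_pos (div_pos hb' h) fun h1 => hne ((div_eq_one_iff_eq h.ne').1 h1).symm
    have hmul := mul_lt_mul_of_pos_left hlog h
    have hinv : Real.log (a / b) = -Real.log (b / a) := by rw [← Real.log_inv, inv_div]
    have hcancel : a * (b / a - 1) = b - a := by field_simp
    rw [hinv]
    linarith
  · obtain rfl : a = 0 := le_antisymm (not_lt.1 h) ha
    have : 0 < b := lt_of_le_of_ne hb hne
    linarith

lemma sub_le_klTerm {a b : ℝ} (ha : 0 ≤ a) (hb : 0 ≤ b) (hab : 0 < a → 0 < b) :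
    a - b ≤ if 0 < a then a * Real.log (a / b) else 0 := by
  rcases eq_or_ne a b with rfl | hne
  · split_ifs with h
    · simp [div_self h.ne']
    · simp
  · exact (sub_lt_klTerm ha hb hab hne).le

/-- Gibbs' inequality. -/
lemma IsPmf.klReal_nonneg {Y : Type*} [Fintype Y] {p q : Y → ℝ} (hp : IsPmf p) (hq : IsPmf q)
    (hpq : ∀ y, 0 < p y → 0 < q y) : 0 ≤ klReal p q := by
  calc (0 : ℝ) = ∑ y, (p y - q y) := by rw [Finset.sum_sub_distrib, hp.2, hq.2, sub_self]
    _ ≤ klReal p q := Finset.sum_le_sum fun y _ => sub_le_klTerm (hp.1 y) (hq.1 y) (hpq y)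

lemma IsPmf.klReal_pos {Y : Type*} [Fintype Y] {p q : Y → ℝ} (hp : IsPmf p) (hq : IsPmf q)
    (hpq : ∀ y, 0 < p y → 0 < q y) (hne : p ≠ q) : 0 < klReal p q := by
  obtain ⟨z, hz⟩ := Function.ne_iff.1 hne
  calc (0 : ℝ) = ∑ y, (p y - q y) := by rw [Finset.sum_sub_distrib, hp.2, hq.2, sub_self]
    _ < klReal p q :=
      Finset.sum_lt_sum (fun y _ => sub_le_klTerm (hp.1 y) (hq.1 y) (hpq y))
        ⟨z, Finset.mem_univ z, sub_lt_klTerm (hp.1 z) (hq.1 z) (hpq z) hz⟩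

lemma IsPmf.midpoint {Y : Type*} [Fintype Y] {p q : Y → ℝ} (hp : IsPmf p) (hq : IsPmf q) :
    IsPmf fun y => (p y + q y) / 2 := by
  refine ⟨fun y => div_nonneg (add_nonneg (hp.1 y) (hq.1 y)) two_pos.le, ?_⟩
  rw [← Finset.sum_div, Finset.sum_add_distrib, hp.2, hq.2]
  norm_num

lemma klTerm_eq {a b : ℝ} (ha : 0 ≤ a) (hab : 0 < a → 0 < b) :
    (if 0 < a then a * Real.log (a / b) else 0) = a * Real.log a - a * Real.log b := by
  split_ifs with h
  · rw [Real.log_div h.ne' (hab h).ne', mul_sub]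
  · obtain rfl : a = 0 := le_antisymm (not_lt.1 h) ha
    simp

/-- The compensation identity for the midpoint of two pmfs. -/
lemma IsPmf.half_klReal_add_half_klReal {Y : Type*} [Fintype Y] {p q Q : Y → ℝ} (hp : IsPmf p)
    (hq : IsPmf q) (hpQ : ∀ y, 0 < p y → 0 < Q y) (hqQ : ∀ y, 0 < q y → 0 < Q y) :
    (1 / 2) * klReal p Q + (1 / 2) * klReal q Q
      = JSD p q + klReal (fun y => (p y + q y) / 2) Q := by
  simp only [JSD, klReal, Finset.mul_sum, ← Finset.sum_add_distrib]
  refine Finset.sum_congr rfl fun y _ => ?_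
  have hp0 := hp.1 y
  have hq0 := hq.1 y
  have hM : 0 < (p y + q y) / 2 → 0 < Q y := fun h => by
    rcases hp0.lt_or_eq with h1 | h1
    · exact hpQ y h1
    · exact hqQ y (by linarith)
  rw [klTerm_eq hp0 (hpQ y), klTerm_eq hq0 (hqQ y), klTerm_eq hp0 (fun h => by linarith),
    klTerm_eq hq0 (fun h => by linarith), klTerm_eq (by linarith) hM]
  ring

lemma IsPmf.JSD_pos {Y : Type*} [Fintype Y] {p q : Y → ℝ} (hp : IsPmf p) (hq : IsPmf q)
    (hne : p ≠ q) : 0 < JSD p q := by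
  have hM := hp.midpoint hq
  have h1 := hp.klReal_pos hM (fun y h => by linarith [hq.1 y]) fun h => hne <| by
    ext y
    linarith [congrFun h y]
  have h2 := hq.klReal_nonneg hM fun y h => by linarith [hp.1 y]
  unfold JSD
  linarith

lemma IsPmf.JSD_le_max_KL {Y : Type*} [Fintype Y] {p q Q : Y → ℝ} (hp : IsPmf p) (hq : IsPmf q)
    (hQ : IsPmf Q) : ((JSD p q : ℝ) : EReal) ≤ max (KL p Q) (KL q Q) := by
  by_cases hpQ : ∀ y, 0 < p y → 0 < Q y
  · by_cases hqQ : ∀ y, 0 < q y → 0 < Q y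
    · have hcomp := hp.half_klReal_add_half_klReal hq hpQ hqQ
      have hM := (hp.midpoint hq).klReal_nonneg hQ fun y h => by
        rcases (hp.1 y).lt_or_eq with h1 | h1
        · exact hpQ y h1
        · exact hqQ y (by linarith)
      rw [KL, KL, if_pos hpQ, if_pos hqQ, le_max_iff, EReal.coe_le_coe_iff, EReal.coe_le_coe_iff]
      by_contra! h
      linarith [h.1, h.2]
    · simp [KL, hqQ]
  · simp [KL, hpQ]

/-- the information radius of a two-point family `{p, q}` of distinct
pmfs is at least `JSD(p‖q)`, which is strictly positive. -/
theorem jsd_le_infoRadius_and_pos {Y : Type*} [Fintype Y] [Nonempty Y]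
    (p q : Y → ℝ) (hp : IsPmf p) (hq : IsPmf q) (hne : p ≠ q) :
    ((JSD p q : ℝ) : EReal) ≤
      (⨅ Q : {Q : Y → ℝ // IsPmf Q}, max (KL p Q.1) (KL q Q.1)) ∧
    0 < JSD p q := by
  exact ⟨le_iInf fun Q => hp.JSD_le_max_KL hq Q.2, hp.JSD_pos hq hne⟩
end

section
/- Let p, q, Q be pmfs on a finite set Y with supp(p) ⊆ supp(q) ⊆ supp(Q). Then D(p‖Q) − D(q‖Q) ≤ χ²(p‖q) + √(χ²(p‖q)) · √(∑_{y∈supp(q)} q(y) · log²(q(y)/Q(y))). -/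
open scoped BigOperators Classical

/-- The χ²-divergence `χ²(p‖q) = ∑_{y : q y > 0} (p y - q y)² / q y`. -/
noncomputable def chiSq {Y : Type*} [Fintype Y] (p q : Y → ℝ) : ℝ :=
  ∑ y, if 0 < q y then (p y - q y) ^ 2 / q y else 0

/-- Pointwise bound `p log (p / Q) - q log (q / Q) ≤ (p - q)² / q + (p - q) + (p - q) log (q / Q)`,
a consequence of `log (p / q) ≤ p / q - 1`. -/
theorem mul_log_div_sub_mul_log_div_le {p q Q : ℝ} (hp : 0 ≤ p) (hq : 0 < q) (hQ : 0 < Q) :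
    p * Real.log (p / Q) - q * Real.log (q / Q) ≤
      (p - q) ^ 2 / q + (p - q) + (p - q) * Real.log (q / Q) := by
  have hsq : (p - q) ^ 2 / q + (p - q) = p * (p / q - 1) := by
    field_simp
    ring
  rw [hsq]
  rcases hp.eq_or_lt with rfl | hp
  · simp
  · have hlog : Real.log (p / Q) = Real.log (p / q) + Real.log (q / Q) := by
      rw [← Real.log_mul (by positivity) (by positivity), div_mul_div_cancel₀ hq.ne']
    have hle := mul_le_mul_of_nonneg_left
      (Real.log_le_sub_one_of_pos (div_pos hp hq)) hp.le
    rw [hlog]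
    linarith

/-- `D(p‖Q) − D(q‖Q) ≤ χ²(p‖q) + √(χ²(p‖q)) · √(∑ q log²(q/Q))`. -/
theorem kl_diff_le_chiSq_bound {Y : Type*} [Fintype Y] [Nonempty Y]
    (p q Q : Y → ℝ) (hp : IsPmf p) (hq : IsPmf q) (hQ : IsPmf Q)
    (hpq : ∀ y, 0 < p y → 0 < q y) (hqQ : ∀ y, 0 < q y → 0 < Q y) :
    klReal p Q - klReal q Q ≤
      chiSq p q + Real.sqrt (chiSq p q) *
        Real.sqrt (∑ y, (if 0 < q y then q y * (Real.log (q y / Q y)) ^ 2 else 0)) := by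
  have hcs := Real.sum_mul_le_sqrt_mul_sqrt Finset.univ
    (fun y => (p y - q y) / √(q y)) (fun y => √(q y) * Real.log (q y / Q y))
  have hchi : ∑ y, ((p y - q y) / √(q y)) ^ 2 = chiSq p q := by
    refine Finset.sum_congr rfl fun y _ => ?_
    rw [div_pow, Real.sq_sqrt (hq.1 y)]
    split_ifs with h
    · rfl
    · simp [le_antisymm (not_lt.mp h) (hq.1 y)]
  have hlog : ∑ y, (√(q y) * Real.log (q y / Q y)) ^ 2 =
      ∑ y, (if 0 < q y then q y * (Real.log (q y / Q y)) ^ 2 else 0) := by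
    refine Finset.sum_congr rfl fun y _ => ?_
    rw [mul_pow, Real.sq_sqrt (hq.1 y)]
    split_ifs with h
    · rfl
    · simp [le_antisymm (not_lt.mp h) (hq.1 y)]
  rw [hchi, hlog] at hcs
  have hsum : klReal p Q - klReal q Q ≤ chiSq p q + ∑ y, (p y - q y) +
      ∑ y, (p y - q y) / √(q y) * (√(q y) * Real.log (q y / Q y)) := by
    unfold klReal chiSq
    rw [← Finset.sum_sub_distrib, ← Finset.sum_add_distrib, ← Finset.sum_add_distrib]
    refine Finset.sum_le_sum fun y _ => ?_
    by_cases h : 0 < q y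
    · have hp_term : (if 0 < p y then p y * Real.log (p y / Q y) else 0) =
          p y * Real.log (p y / Q y) := by
        split_ifs with h'
        · rfl
        · simp [le_antisymm (not_lt.mp h') (hp.1 y)]
      rw [hp_term, if_pos h, if_pos h, ← mul_assoc, div_mul_cancel₀ _ (Real.sqrt_pos.mpr h).ne']
      exact mul_log_div_sub_mul_log_div_le (hp.1 y) h (hqQ y h)
    · have hq0 : q y = 0 := le_antisymm (not_lt.mp h) (hq.1 y)
      have hp0 : p y = 0 := le_antisymm (not_lt.mp fun h' => h (hpq y h')) (hp.1 y)
      simp [hq0, hp0]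
  have hzero : ∑ y, (p y - q y) = 0 := by
    rw [Finset.sum_sub_distrib, hp.2, hq.2, sub_self]
  linarith
end

section
/- Let q, Q be pmfs on a finite set Y, let 0 < η with Q(y) ≥ η for all y ∈ Y, and let κ = min{q(y) : y ∈ Y, q(y) > 0}. Assume η ≤ κ and let C ≥ D(q‖Q) with C ≥ 0. Then the second moment of the log-likelihood ratio satisfies ∑_{y∈supp(q)} q(y) · log²(q(y)/Q(y)) ≤ C · log(κ/η) + log(1/η) · log(1/κ). -/
open scoped BigOperators Classical

/-- second-moment bound, via Bhatia–Davis: if `Q y ≥ η > 0` for all `y`,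
`κ` is the smallest positive mass of `q`, `η ≤ κ`, and `C ≥ max(D(q‖Q), 0)`, then
`∑_{y ∈ supp q} q y · log²(q y / Q y) ≤ C log(κ/η) + log(1/η) log(1/κ)`. -/
theorem second_moment_log_ratio_le {Y : Type*} [Fintype Y] [Nonempty Y]
    (q Q : Y → ℝ) (hq : IsPmf q) (hQ : IsPmf Q)
    (η : ℝ) (hη : 0 < η) (hQη : ∀ y, η ≤ Q y)
    (κ : ℝ) (hκmem : ∃ y, 0 < q y ∧ q y = κ) (hκmin : ∀ y, 0 < q y → κ ≤ q y)
    (hηκ : η ≤ κ)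
    (C : ℝ) (hC0 : 0 ≤ C) (hCD : klReal q Q ≤ C) :
    ∑ y, (if 0 < q y then q y * (Real.log (q y / Q y)) ^ 2 else 0) ≤
      C * Real.log (κ / η) + Real.log (1 / η) * Real.log (1 / κ) := by
  obtain ⟨y₀, hy₀, rfl⟩ := hκmem
  have hlog_div : Real.log (q y₀ / η) = Real.log (1 / η) - Real.log (1 / q y₀) := by
    rw [Real.log_div hy₀.ne' hη.ne']
    simp only [one_div, Real.log_inv]
    ring
  have hlog_nonneg : 0 ≤ Real.log (q y₀ / η) := Real.log_nonneg ((one_le_div hη).2 hηκ)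
  have hle_one : ∀ p : Y → ℝ, IsPmf p → ∀ y, p y ≤ 1 := fun p hp y =>
    hp.2 ▸ Finset.single_le_sum (fun z _ => hp.1 z) (Finset.mem_univ y)
  have hpoint : ∀ y, (if 0 < q y then q y * (Real.log (q y / Q y)) ^ 2 else 0) ≤
      (if 0 < q y then q y * Real.log (q y / Q y) else 0) * Real.log (q y₀ / η) +
        q y * (Real.log (1 / η) * Real.log (1 / q y₀)) := by
    intro y
    split_ifs with hy
    · have hQy : 0 < Q y := hη.trans_le (hQη y)
      have hupper : Real.log (q y / Q y) ≤ Real.log (1 / η) :=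
        Real.log_le_log (div_pos hy hQy)
          (div_le_div₀ zero_le_one (hle_one q hq y) hη (hQη y))
      have hlower : -Real.log (1 / q y₀) ≤ Real.log (q y / Q y) := by
        rw [one_div, Real.log_inv, neg_neg]
        refine Real.log_le_log hy₀ ((hκmin y hy).trans ?_)
        exact le_div_self hy.le hQy (hle_one Q hQ y)
      rw [hlog_div]
      nlinarith [mul_nonneg hy.le
        (mul_nonneg (sub_nonneg.2 hupper) (sub_nonneg.2 hlower))]
    · have hzero : q y = 0 := le_antisymm (not_lt.1 hy) (hq.1 y)
      simp [hzero]
  calc _ ≤ ∑ y, ((if 0 < q y then q y * Real.log (q y / Q y) else 0) * Real.log (q y₀ / η) +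
        q y * (Real.log (1 / η) * Real.log (1 / q y₀))) := Finset.sum_le_sum fun y _ => hpoint y
    _ = klReal q Q * Real.log (q y₀ / η) + Real.log (1 / η) * Real.log (1 / q y₀) := by
      rw [Finset.sum_add_distrib, ← Finset.sum_mul, ← Finset.sum_mul, hq.2, one_mul, klReal]
    _ ≤ _ := by gcongr
end

section
/- For any nonempty subset S ⊆ X of the input alphabet of a finite channel W and any 0 < η ≤ 1/(2|Y|), the pseudo-capacity and the capacity satisfy C(W_S) ≤ C_η(W_S) ≤ C(W_S) + 2·η·|Y|. -/
open scoped BigOperators Classical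

/-- The pseudo-capacity: the information radius over the pseudo-simplex
`P_η(Y) = {Q pmf : Q y ≥ η ∀ y}`, with the convention for `S = ∅` set to `0`. -/
noncomputable def pseudoCapacity {X Y : Type*} [Fintype X] [Fintype Y]
    (η : ℝ) (P : X → Y → ℝ) (S : Set X) : EReal :=
  if S.Nonempty then
    ⨅ Q : {Q : Y → ℝ // IsPmf Q ∧ ∀ y, η ≤ Q y}, ⨆ x : S, KL (P (x : X)) Q.1
  else 0

/-- The mixture `(1 - η|Y|) Q + η|Y| U` of `Q` with the uniform pmf `U` lies in the
pseudo-simplex. -/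
theorem IsPmf.mixUniform_mem {Y : Type*} [Fintype Y] {Q : Y → ℝ} (hQ : IsPmf Q) {η : ℝ}
    (hη : η * (Fintype.card Y : ℝ) ≤ 1) (hη0 : 0 ≤ η) :
    IsPmf (fun y => (1 - η * (Fintype.card Y : ℝ)) * Q y + η) ∧
      ∀ y, η ≤ (1 - η * (Fintype.card Y : ℝ)) * Q y + η := by
  have hle : ∀ y, η ≤ (1 - η * (Fintype.card Y : ℝ)) * Q y + η := fun y =>
    le_add_of_nonneg_left (mul_nonneg (sub_nonneg.2 hη) (hQ.1 y))
  refine ⟨⟨fun y => hη0.trans (hle y), ?_⟩, hle⟩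
  rw [Finset.sum_add_distrib, ← Finset.mul_sum, hQ.2, Finset.sum_const, Finset.card_univ,
    nsmul_eq_mul]
  ring

/-- If `Q'` dominates `exp (-c) * Q`, replacing `Q` by `Q'` increases the divergence
by at most `c`. -/
theorem KL_le_KL_add_of_exp_mul_le {Y : Type*} [Fintype Y] {p Q Q' : Y → ℝ} (hp : IsPmf p)
    {c : ℝ} (h : ∀ y, Real.exp (-c) * Q y ≤ Q' y) : KL p Q' ≤ KL p Q + (c : EReal) := by
  by_cases hs : ∀ y, 0 < p y → 0 < Q y
  · have hs' : ∀ y, 0 < p y → 0 < Q' y := fun y hy =>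
      (mul_pos (Real.exp_pos _) (hs y hy)).trans_le (h y)
    rw [KL, KL, if_pos hs, if_pos hs', ← EReal.coe_add, EReal.coe_le_coe_iff]
    have hc : c = ∑ y, p y * c := by rw [← Finset.sum_mul, hp.2, one_mul]
    rw [klReal, klReal]
    conv_rhs => rw [hc]
    rw [← Finset.sum_add_distrib]
    refine Finset.sum_le_sum fun y _ => ?_
    split_ifs with hy
    · have hlog := Real.log_le_log (mul_pos (Real.exp_pos _) (hs y hy)) (h y)
      rw [Real.log_mul (Real.exp_ne_zero _) (hs y hy).ne', Real.log_exp] at hlog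
      rw [Real.log_div hy.ne' (hs y hy).ne', Real.log_div hy.ne' (hs' y hy).ne', ← mul_add]
      exact mul_le_mul_of_nonneg_left (by linarith) hy.le
    · rw [le_antisymm (not_lt.1 hy) (hp.1 y)]
      simp
  · rw [KL, KL, if_neg hs, EReal.top_add_coe]
    exact le_top

theorem exp_neg_two_mul_le_one_sub {t : ℝ} (h0 : 0 ≤ t) (h : t ≤ 1 / 2) :
    Real.exp (-(2 * t)) ≤ 1 - t := by
  have h1 : 0 < 1 - t := by linarith
  rw [Real.exp_neg]
  refine inv_le_of_inv_le₀ h1 (le_trans ?_ (Real.add_one_le_exp (2 * t)))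
  rw [inv_le_iff_one_le_mul₀ h1]
  nlinarith

/-- for `0 < η ≤ 1/(2|Y|)`, the pseudo-capacity and the capacity satisfy
`C(W_S) ≤ C_η(W_S) ≤ C(W_S) + 2η|Y|`. -/
theorem capacity_le_pseudoCapacity_le
    {X Y : Type*} [Fintype X] [Fintype Y] [Nonempty X] [Nonempty Y]
    (P : X → Y → ℝ) (hP : ∀ x, IsPmf (P x)) (S : Set X) (hS : S.Nonempty)
    (η : ℝ) (hη : 0 < η) (hη2 : η ≤ 1 / (2 * (Fintype.card Y : ℝ))) :
    capacity P S ≤ pseudoCapacity η P S ∧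
      pseudoCapacity η P S ≤ capacity P S + ((2 * η * (Fintype.card Y : ℝ) : ℝ) : EReal) := by
  have hn : (0 : ℝ) < Fintype.card Y := by exact_mod_cast Fintype.card_pos
  have ht : η * (Fintype.card Y : ℝ) ≤ 1 / 2 := by
    rw [le_div_iff₀ (by positivity)] at hη2
    linarith
  rw [capacity, pseudoCapacity, if_pos hS, if_pos hS]
  constructor
  · exact le_iInf fun Q => iInf_le
      (fun Q : {Q : Y → ℝ // IsPmf Q} => ⨆ x : S, KL (P (x : X)) Q.1) ⟨Q.1, Q.2.1⟩
  · rw [← EReal.sub_le_iff_le_add (Or.inl (EReal.coe_ne_bot _)) (Or.inl (EReal.coe_ne_top _))]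
    refine le_iInf fun Q => ?_
    rw [EReal.sub_le_iff_le_add (Or.inl (EReal.coe_ne_bot _)) (Or.inl (EReal.coe_ne_top _))]
    refine iInf_le_of_le ⟨_, Q.2.mixUniform_mem (by linarith) hη.le⟩ (iSup_le fun x => ?_)
    refine (KL_le_KL_add_of_exp_mul_le (hP x) fun y => ?_).trans
      (add_le_add_left (le_iSup (fun x : S => KL (P (x : X)) Q.1) x) _)
    rw [mul_assoc 2 η]
    have := mul_le_mul_of_nonneg_right
      (exp_neg_two_mul_le_one_sub (by positivity) ht) (Q.2.1 y)
    linarith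
end

section
/- Let R ⊆ X be nonempty and partition X∖R into disjoint sets A and B such that for each a ∈ A the row P_a lies in hull(W_R), and for each b ∈ B the row P_b does not lie in hull(W_R). For each b ∈ B let m_b ∈ hull(W_R) with supp(P_b) ⊆ supp(m_b) attain min{χ²(P_b‖m) : m ∈ hull(W_R), supp(P_b) ⊆ supp(m)}. Define the channel W′ as the family (P_r)_{r∈R} together with (P_b)_{b∈B}, and the channel W″ as the family (P_r)_{r∈R} together with (m_b)_{b∈B} (both indexed by the disjoint union R ⊔ B, with capacity given by the same information-radius formula applied to the respective family of pmfs). Then C(W_X) − C(W_R) ≤ C(W′) − C(W″). -/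
open scoped BigOperators Classical

/-- Membership in the convex hull of the rows `(P_r)_{r ∈ S}` of the channel. -/
def hullMem {X Y : Type*} [Fintype X] [Fintype Y]
    (P : X → Y → ℝ) (S : Set X) (m : Y → ℝ) : Prop :=
  ∃ c : X → ℝ, (∀ x, 0 ≤ c x) ∧ (∀ x, x ∉ S → c x = 0) ∧ (∑ x, c x) = 1 ∧
    ∀ y, m y = ∑ x, c x * P x y

/-- The information radius of an arbitrary finite family of pmfs (capacity via the
minimax formula for a channel given as an indexed family). -/
noncomputable def infoRadius {ι Y : Type*} [Fintype Y] (P : ι → Y → ℝ) : EReal :=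
  ⨅ Q : {Q : Y → ℝ // IsPmf Q}, ⨆ i, KL (P i) Q.1

/-- For fixed `q`, the divergence `p ↦ D(p‖q)` is convex on the nonnegative functions whose support
lies in that of `q`. -/
theorem convexOn_klReal {Y : Type*} [Fintype Y] {q : Y → ℝ} (hq : ∀ y, 0 ≤ q y) :
    ConvexOn ℝ {p : Y → ℝ | ∀ y, 0 ≤ p y ∧ (0 < p y → 0 < q y)} (fun p => klReal p q) := by
  refine ⟨fun p hp p' hp' a b ha hb _ y => ⟨?_, fun hpos => ?_⟩,
    fun p hp p' hp' a b ha hb hab => ?_⟩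
  · exact add_nonneg (mul_nonneg ha (hp y).1) (mul_nonneg hb (hp' y).1)
  · by_contra hqy
    have h0 : p y = 0 := le_antisymm (not_lt.1 (mt (hp y).2 hqy)) (hp y).1
    have h1 : p' y = 0 := le_antisymm (not_lt.1 (mt (hp' y).2 hqy)) (hp' y).1
    simp [h0, h1] at hpos
  · have term : ∀ u : Y → ℝ, ∀ y, 0 ≤ u y →
        (if 0 < u y then u y * Real.log (u y / q y) else 0) = u y * Real.log (u y / q y) := by
      intro u y hu
      split_ifs with h
      · rfl
      · simp [le_antisymm (not_lt.1 h) hu]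
    simp only [klReal, smul_eq_mul, Finset.mul_sum, ← Finset.sum_add_distrib]
    refine Finset.sum_le_sum fun y _ => ?_
    rw [term p y (hp y).1, term p' y (hp' y).1, term (a • p + b • p') y
      (add_nonneg (mul_nonneg ha (hp y).1) (mul_nonneg hb (hp' y).1))]
    simp only [Pi.add_apply, Pi.smul_apply, smul_eq_mul]
    rcases (hq y).eq_or_lt with hqy | hqy
    · simp [← hqy]
    · have h := Real.convexOn_mul_log.2 (x := p y / q y) (y := p' y / q y)
        (div_nonneg (hp y).1 hqy.le) (div_nonneg (hp' y).1 hqy.le) ha hb hab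
      simp only [smul_eq_mul] at h
      have h' := mul_le_mul_of_nonneg_left h hqy.le
      have e : a * (p y / q y) + b * (p' y / q y) = (a * p y + b * p' y) / q y := by ring
      rw [e] at h'
      calc _ = q y * ((a * p y + b * p' y) / q y *
              Real.log ((a * p y + b * p' y) / q y)) := by field_simp
        _ ≤ _ := h'
        _ = _ := by field_simp

/-- The divergence from a point of the convex hull is at most the largest divergence from a row. -/
theorem KL_le_iSup_of_hullMem {X Y : Type*} [Fintype X] [Fintype Y]
    {P : X → Y → ℝ} {R : Set X} (hP : ∀ x ∈ R, ∀ y, 0 ≤ P x y)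
    {m : Y → ℝ} (hm : hullMem P R m) {q : Y → ℝ} (hq : ∀ y, 0 ≤ q y) :
    KL m q ≤ ⨆ r : R, KL (P r) q := by
  by_cases hsupp : ∀ r ∈ R, ∀ y, 0 < P r y → 0 < q y
  · obtain ⟨c, hc0, hcR, hc1, hcm⟩ := hm
    have hmem : ∀ r ∈ R.toFinset,
        P r ∈ {p : Y → ℝ | ∀ y, 0 ≤ p y ∧ (0 < p y → 0 < q y)} := fun r hr y =>
      ⟨hP r (Set.mem_toFinset.1 hr) y, hsupp r (Set.mem_toFinset.1 hr) y⟩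
    have hsum : ∑ x ∈ R.toFinset, c x = 1 := by
      rw [← hc1]
      exact Finset.sum_subset (Finset.subset_univ _) fun x _ hx => hcR x (by simpa using hx)
    have hcenter : R.toFinset.centerMass c P = m := by
      rw [Finset.centerMass_eq_of_sum_1 _ _ hsum]
      ext y
      rw [hcm, Finset.sum_apply]
      exact Finset.sum_subset (Finset.subset_univ _) fun x _ hx => by
        simp [hcR x (by simpa using hx)]
    have hms := (convexOn_klReal hq).1.centerMass_mem (fun x _ => hc0 x)
      (hsum ▸ one_pos) hmem
    obtain ⟨r, hr, hle⟩ := (convexOn_klReal hq).exists_ge_of_centerMass (fun x _ => hc0 x)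
      (hsum ▸ one_pos) hmem
    rw [hcenter] at hle hms
    have hrR : r ∈ R := Set.mem_toFinset.1 hr
    refine le_trans ?_ (le_iSup (fun r : R => KL (P r) q) ⟨r, hrR⟩)
    rw [KL, KL, if_pos fun y => (hms y).2, if_pos (hsupp r hrR)]
    exact EReal.coe_le_coe_iff.2 hle
  · push Not at hsupp
    obtain ⟨r, hr, y, hy, hqy⟩ := hsupp
    refine le_trans le_top (le_trans (le_of_eq ?_) (le_iSup (fun r : R => KL (P r) q) ⟨r, hr⟩))
    rw [KL, if_neg fun h => (h y hy).not_ge hqy]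

/-- with `X ∖ R` partitioned into symbols `A` inside and `B` outside
the convex hull of `W_R`, and `m_b` the χ²-closest point of the hull to `P_b` for
`b ∈ B`, we have `C(W_X) − C(W_R) ≤ C(W′) − C(W″)`, where `W′` consists of the rows
of `R` and `B`, and `W″` of the rows of `R` together with the `m_b`. -/
theorem capacity_diff_le_hull_replacement
    {X Y : Type*} [Fintype X] [Fintype Y] [Nonempty Y]
    (P : X → Y → ℝ) (hP : ∀ x, IsPmf (P x))
    (R A B : Set X) (hR : R.Nonempty)
    (hcover : A ∪ B = Set.univ \ R) (hdisj : A ∩ B = ∅)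
    (hA : ∀ a ∈ A, hullMem P R (P a))
    (hB : ∀ b ∈ B, ¬ hullMem P R (P b))
    (m : X → Y → ℝ)
    (hm : ∀ b ∈ B, hullMem P R (m b) ∧ (∀ y, 0 < P b y → 0 < m b y) ∧
      ∀ m', hullMem P R m' → (∀ y, 0 < P b y → 0 < m' y) →
        chiSq (P b) (m b) ≤ chiSq (P b) m') :
    capacity P Set.univ - capacity P R ≤
      infoRadius (Sum.elim (fun r : R => P (r : X)) (fun b : B => P (b : X))) -
        infoRadius (Sum.elim (fun r : R => P (r : X)) (fun b : B => m (b : X))) := by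
  have nonneg : ∀ x ∈ R, ∀ y, 0 ≤ P x y := fun x _ => (hP x).1
  have hX : capacity P Set.univ =
      infoRadius (Sum.elim (fun r : R => P (r : X)) (fun b : B => P (b : X))) := by
    rw [capacity, if_pos (hR.mono (Set.subset_univ R)), infoRadius]
    refine iInf_congr fun Q => le_antisymm (iSup_le fun x => ?_) (iSup_le ?_)
    · rw [iSup_sum]
      by_cases hxR : (x : X) ∈ R
      · exact le_sup_of_le_left (le_iSup (fun r : R => KL (P r) Q.1) ⟨x, hxR⟩)
      · have hx : (x : X) ∈ A ∪ B := hcover ▸ ⟨trivial, hxR⟩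
        rcases hx with hxA | hxB
        · exact le_sup_of_le_left (KL_le_iSup_of_hullMem nonneg (hA x hxA) Q.2.1)
        · exact le_sup_of_le_right (le_iSup (fun b : B => KL (P b) Q.1) ⟨x, hxB⟩)
    · rintro (r | b)
      · exact le_iSup (fun x : (Set.univ : Set X) => KL (P x) Q.1) ⟨r, trivial⟩
      · exact le_iSup (fun x : (Set.univ : Set X) => KL (P x) Q.1) ⟨b, trivial⟩
  have hRm : capacity P R =
      infoRadius (Sum.elim (fun r : R => P (r : X)) (fun b : B => m (b : X))) := by
    rw [capacity, if_pos hR, infoRadius]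
    refine iInf_congr fun Q => ?_
    rw [iSup_sum]
    exact (sup_eq_left.2 (iSup_le fun b : B =>
      KL_le_iSup_of_hullMem nonneg (hm b b.2).1 Q.2.1)).symm
  rw [hX, hRm]
end
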